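/- Let P be a Poisson algebra over ℝ with identity. Suppose that the derived ideal D = span{ {f,g} : f,g ∈ P } has codimension 1 as a linear subspace of P, and that for every f ∈ P, f² ∈ D implies f = 0. Then for every finite-dimensional real vector space V and every Lie algebra homomorphism ρ from (P, {·,·}) to the endomorphisms of V with the commutator bracket, one has ρ({f,g}) = 0 for all f, g ∈ P. (Thus every finite-dimensional Lie representation of P factors through the at most one-dimensional quotient P/D.) -/

import Mathlib

namespace Subalgebra

variable {R P : Type*} [CommRing R] [CommRing P] [Algebra R P]

/-- The largest ideal of the ambient algebra contained in a subalgebra. -/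
def conductorIdeal (A : Subalgebra R P) : Ideal P where
  carrier := {f | ∀ p, f * p ∈ A}
  zero_mem' p := by simp
  add_mem' hf hg p := by
    rw [add_mul]
    exact A.add_mem (hf p) (hg p)
  smul_mem' c f hf p := by
    rw [smul_eq_mul, mul_comm c f, mul_assoc]
    exact hf (c * p)

theorem conductorIdeal_cofg [IsNoetherianRing R] (A : Subalgebra R P)
    (hA : (Subalgebra.toSubmodule A).CoFG) :
    (A.conductorIdeal.restrictScalars R).CoFG := by
  set S := Subalgebra.toSubmodule A
  obtain ⟨n, s, hs⟩ := Module.Finite.exists_fin (R := R) (M := P ⧸ S)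
  choose c hc using fun i => S.mkQ_surjective (s i)
  let φ : P →ₗ[R] (P ⧸ S) × (Fin n → P ⧸ S) :=
    S.mkQ.prod (LinearMap.pi fun i => S.mkQ ∘ₗ LinearMap.mulRight R (c i))
  refine Submodule.CoFG.of_le (S := LinearMap.ker φ) ?_ (Submodule.CoFG.ker φ)
  intro f hf
  obtain ⟨hfA, hfc⟩ : f ∈ A ∧ ∀ i, f * c i ∈ A := by
    simpa [φ, funext_iff, Prod.ext_iff, S,
      Submodule.Quotient.mk_eq_zero] using hf
  have hspan : S ⊔ Submodule.span R (Set.range c) = ⊤ := by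
    have hmap : (Submodule.span R (Set.range c)).map S.mkQ = ⊤ := by
      rw [Submodule.map_span, ← Set.range_comp, ← hs]
      exact congrArg _ (congrArg _ (funext hc))
    have h := congrArg (Submodule.comap S.mkQ) hmap
    rwa [Submodule.comap_map_mkQ, Submodule.comap_top] at h
  have hle : S ⊔ Submodule.span R (Set.range c) ≤ S.comap (LinearMap.mulLeft R f) := by
    refine sup_le (fun a ha => A.mul_mem hfA ha) (Submodule.span_le.2 ?_)
    rintro _ ⟨i, rfl⟩
    exact hfc i
  exact fun p => hle (hspan ▸ Submodule.mem_top (x := p))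

end Subalgebra

namespace Derivation

open Polynomial

variable {K P : Type*} [Field K] [CharZero K] [CommRing P] [Algebra K P]

theorem mem_radical_of_aeval_mul_pow_mem (d : Derivation K P P) {J : Ideal P}
    (hJ : ∀ x ∈ J, d x ∈ J) (q : P) (p : K[X]) (hp : p ≠ 0) (m : ℕ)
    (h : aeval q p * d q ^ m ∈ J) : d q ∈ J.radical := by
  induction hn : p.natDegree using Nat.strong_induction_on generalizing p m with
  | _ n ih =>
    subst hn
    by_cases h0 : p.natDegree = 0
    · obtain ⟨c, rfl⟩ := natDegree_eq_zero.1 h0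
      have hc : IsUnit (algebraMap K P c) :=
        (IsUnit.mk0 c fun hc => hp (by rw [hc, C_0])).map _
      rw [aeval_C] at h
      exact ⟨m, (Ideal.unit_mul_mem_iff_mem J hc).1 h⟩
    · refine ih _ (natDegree_derivative_lt h0) (derivative p)
        (mt derivative_eq_zero.1 h0) (m + 2) ?_ rfl
      have hd := J.mul_mem_left (d q) (hJ _ h)
      have key : aeval q (derivative p) * d q ^ (m + 2) =
          d q * d (aeval q p * d q ^ m) -
            (m * d (d q)) * (aeval q p * d q ^ m) := by
        rcases m with _ | m
        · simp [map_aeval]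
          ring
        · simp [map_aeval, leibniz_pow]
          ring
      rw [key]
      exact J.sub_mem hd (J.mul_mem_left _ h)

/-- A derivation preserving an ideal of finite codimension takes values in its radical. -/
theorem mem_radical_of_cofg (d : Derivation K P P) {J : Ideal P}
    (hJ : ∀ x ∈ J, d x ∈ J) (hfin : (J.restrictScalars K).CoFG) (q : P) :
    d q ∈ J.radical := by
  have := hfin
  let φ : K[X] →ₗ[K] P ⧸ J.restrictScalars K :=
    (J.restrictScalars K).mkQ ∘ₗ (aeval q).toLinearMap
  have hφ : ¬ Function.Injective φ := fun hinj =>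
    Polynomial.not_finite (R := K) (Module.Finite.of_injective φ hinj)
  obtain ⟨p, hp, hp0⟩ := (Submodule.ne_bot_iff _).1 (mt LinearMap.ker_eq_bot.1 hφ)
  refine d.mem_radical_of_aeval_mul_pow_mem hJ q p hp0 0 ?_
  simpa [φ, Submodule.Quotient.mk_eq_zero] using hp

end Derivation

/-- Let `P` be a unital Poisson algebra over `ℝ` whose derived ideal
`D = span {P,P}` has codimension 1, and suppose `f² ∈ D → f = 0`. Then every
finite-dimensional Lie representation `ρ : P → End V` kills all brackets:
`ρ {f,g} = 0`. -/
theorem no_nontrivial_finite_dim_lie_rep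
    {P : Type*} [CommRing P] [Algebra ℝ P]
    (br : P →ₗ[ℝ] P →ₗ[ℝ] P)
    (anti : ∀ f g : P, br f g = - br g f)
    (jacobi : ∀ f g h : P, br f (br g h) = br (br f g) h + br g (br f h))
    (leibniz : ∀ f g h : P, br f (g * h) = br f g * h + g * br f h)
    (hcodim : Module.finrank ℝ (P ⧸ Submodule.span ℝ {x : P | ∃ f g : P, x = br f g}) = 1)
    (hsq : ∀ f : P, f ^ 2 ∈ Submodule.span ℝ {x : P | ∃ f g : P, x = br f g} → f = 0) :
    ∀ (V : Type) [AddCommGroup V] [Module ℝ V] [FiniteDimensional ℝ V]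
      (ρ : P →ₗ[ℝ] Module.End ℝ V),
      (∀ f g : P, ρ (br f g) = ρ f * ρ g - ρ g * ρ f) →
      ∀ f g : P, ρ (br f g) = 0 := by
  intro V _ _ _ ρ hρ
  set D := Submodule.span ℝ {x : P | ∃ f g : P, x = br f g}
  have hker (f g : P) (hg : ρ g = 0) : ρ (br f g) = 0 := by simp [hρ, hg]
  let U : Submodule ℝ P := ⨅ f, LinearMap.ker (ρ ∘ₗ br f)
  have hU (g : P) : g ∈ U ↔ ∀ f, ρ (br f g) = 0 := by simp [U]
  have hUbr (f u : P) (hu : u ∈ U) : br f u ∈ U :=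
    (hU _).2 fun g => hker g _ ((hU u).1 hu f)
  have hone (f : P) : br f 1 = 0 := by simpa using leibniz f 1 1
  have h1U : (1 : P) ∈ U := (hU 1).2 fun f => by simp [hone]
  have hmulU (a u : P) (ha : ρ a = 0) (hu : u ∈ U) : a * u ∈ U := by
    refine (hU _).2 fun f => ?_
    have key : br f (a * u) = br (f * u) a + br (f * a) u := by
      rw [anti (f * u), anti (f * a), leibniz, leibniz, leibniz, anti a f, anti u f, anti u a]
      ring
    rw [key, map_add, hker _ _ ha, (hU u).1 hu, add_zero]
  let A : Subalgebra ℝ P :=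
    { carrier := {a | ∀ u ∈ U, a * u ∈ U}
      mul_mem' := fun ha hb u hu => by
        rw [mul_assoc]
        exact ha _ (hb u hu)
      add_mem' := fun ha hb u hu => by
        rw [add_mul]
        exact U.add_mem (ha u hu) (hb u hu)
      algebraMap_mem' := fun r u hu => by
        rw [← Algebra.smul_def]
        exact U.smul_mem r hu }
  have hAbr (f a : P) (ha : a ∈ A) : br f a ∈ A := fun u hu => by
    rw [eq_sub_of_add_eq (leibniz f a u).symm]
    exact U.sub_mem (hUbr f _ (ha u hu)) (ha _ (hUbr f u hu))
  have hA : (Subalgebra.toSubmodule A).CoFG :=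
    Submodule.CoFG.of_le (S := LinearMap.ker ρ) (fun a ha u hu => hmulU a u ha hu)
      (Submodule.CoFG.ker ρ)
  set J := A.conductorIdeal
  have hJbr (f x : P) (hx : x ∈ J) : br f x ∈ J := fun p => by
    rw [eq_sub_of_add_eq (leibniz f x p).symm]
    exact A.sub_mem (hAbr f _ (hx p)) (hx _)
  have hrad (f g : P) : br f g ∈ J.radical :=
    (Derivation.mk' (br f) fun a b => by
      rw [leibniz, smul_eq_mul, smul_eq_mul]; ring).mem_radical_of_cofg
      (hJbr f) (A.conductorIdeal_cofg hA) g
  have hDrad : D ≤ J.radical.restrictScalars ℝ := by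
    refine Submodule.span_le.2 ?_
    rintro _ ⟨f, g, rfl⟩
    exact hrad f g
  have hcoatom : IsCoatom D :=
    isSimpleModule_iff_isCoatom.1 (isSimpleModule_iff_finrank_eq_one.2 hcodim)
  intro f g
  rcases hcoatom.le_iff.1 hDrad with htop | heq
  · have h1 : (1 : P) ∈ J := by
      have : (1 : P) ∈ J.radical.restrictScalars ℝ := htop ▸ Submodule.mem_top
      obtain ⟨n, hn⟩ := this
      simpa using hn
    have hgA : g ∈ A := by simpa using h1 g
    have hgU : g ∈ U := by simpa using hgA 1 h1U
    exact (hU g).1 hgU f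
  · have hzero : br f g = 0 := by
      refine hsq _ ?_
      rw [← heq]
      exact J.radical.pow_mem_of_mem (hrad f g) 2 two_pos
    rw [hzero, map_zero]
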